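/- An α-Stieltjes right-nonnegative definite sequence (s_j)_{j=0}^{m} is extendable (belongs to K^{≥,e}_{q,m,α}) if and only if Z_{m,m} = 0, which in turn is equivalent to requiring ker(s_0^{[k,α]}) ⊆ ker(s_{m−k}^{[k,α]}) for all 0 ≤ k ≤ m−1 (automatically satisfied when m = 0). -/

import Mathlib

open Matrix BigOperators ComplexOrder

def IsMP {m n : Type*} [Fintype m] [Fintype n] (A : Matrix m n ℂ) (B : Matrix n m ℂ) : Prop :=
  A * B * A = A ∧ B * A * B = B ∧ (A * B)ᴴ = A * B ∧ (B * A)ᴴ = B * A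

open Classical in
noncomputable def mp {m n : Type*} [Fintype m] [Fintype n] (A : Matrix m n ℂ) : Matrix n m ℂ :=
  if h : ∃ B, IsMP A B then h.choose else 0

noncomputable def recip {p q : ℕ} (s : ℕ → Matrix (Fin p) (Fin q) ℂ) :
    ℕ → Matrix (Fin q) (Fin p) ℂ
  | 0 => mp (s 0)
  | (j+1) => -(mp (s 0) * ∑ l : Fin (j+1), s (j+1 - l.val) * recip s l.val)
termination_by j => j
decreasing_by exact l.isLt

noncomputable def shiftA {p q : ℕ} (α : ℂ) (s : ℕ → Matrix (Fin p) (Fin q) ℂ) :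
    ℕ → Matrix (Fin p) (Fin q) ℂ
  | 0 => s 0
  | (j+1) => (-α) • s j + s (j+1)

noncomputable def recipA {p q : ℕ} (α : ℂ) (s : ℕ → Matrix (Fin p) (Fin q) ℂ) :
    ℕ → Matrix (Fin q) (Fin p) ℂ :=
  recip (shiftA α s)

/-- the first α-Schur transform. -/
noncomputable def schur1 {p q : ℕ} (α : ℂ) (s : ℕ → Matrix (Fin p) (Fin q) ℂ) :
    ℕ → Matrix (Fin p) (Fin q) ℂ :=
  fun j => s 0 * (-(recipA α s (j + 1))) * s 0

/-- block Hankel matrix H_n = [s_{j+k}]_{j,k=0}^{n}. -/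
def hankelMat {p q : ℕ} (s : ℕ → Matrix (Fin p) (Fin q) ℂ) (n : ℕ) :
    Matrix (Fin (n + 1) × Fin p) (Fin (n + 1) × Fin q) ℂ :=
  Matrix.of fun jk lm => s (jk.1.val + lm.1.val) jk.2 lm.2

/-- block Hankel matrix K_n = [s_{j+k+1}]_{j,k=0}^{n}. -/
def hankelKMat {p q : ℕ} (s : ℕ → Matrix (Fin p) (Fin q) ℂ) (n : ℕ) :
    Matrix (Fin (n + 1) × Fin p) (Fin (n + 1) × Fin q) ℂ :=
  Matrix.of fun jk lm => s (jk.1.val + lm.1.val + 1) jk.2 lm.2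

/-- the class K^{≥}_{q,κ,α} of α-Stieltjes right-nonnegative definite sequences. -/
def Kgg {q : ℕ} (α : ℝ) (κ : ℕ∞) (s : ℕ → Matrix (Fin q) (Fin q) ℂ) : Prop :=
  (∀ n : ℕ, ((2 * n : ℕ) : ℕ∞) ≤ κ → (hankelMat s n).PosSemidef) ∧
  (∀ n : ℕ, ((2 * n + 1 : ℕ) : ℕ∞) ≤ κ →
    ((-(α : ℂ)) • hankelMat s n + hankelKMat s n).PosSemidef)

/-- P_{j,k} = s_j^{[k,α]} − s_0^{[k,α]}(s_0^{[k,α]})^+ s_j^{[k,α]}(s_0^{[k,α]})^+ s_0^{[k,α]}. -/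
noncomputable def Pjk {q : ℕ} (α : ℂ) (s : ℕ → Matrix (Fin q) (Fin q) ℂ) (j k : ℕ) :
    Matrix (Fin q) (Fin q) ℂ :=
  (schur1 α)^[k] s j -
    (schur1 α)^[k] s 0 * mp ((schur1 α)^[k] s 0) * (schur1 α)^[k] s j *
      mp ((schur1 α)^[k] s 0) * (schur1 α)^[k] s 0

/-- The convolution identities relating a sequence `a` to its Schur transform `c`, where `b` is a
reflexive generalized inverse of `a 0`. -/
structure SchurPair {R : Type*} [Ring R] (b : R) (a c : ℕ → R) : Prop where
  inner : b * a 0 * b = b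
  left_seq : ∀ j, a 0 * b * a j = a j
  right_seq : ∀ j, a j * b * a 0 = a j
  left : ∀ j, a 0 * b * c j = c j
  right : ∀ j, c j * b * a 0 = c j
  succ : ∀ j, a (j + 1) = ∑ l ∈ Finset.range (j + 1), a (j - l) * b * c l
  succ' : ∀ j, a (j + 1) = ∑ l ∈ Finset.range (j + 1), c l * b * a (j - l)

section Ring

variable {R : Type*} [Ring R]

theorem PowerSeries.eq_zero_of_eq_X_mul_mul {D U : PowerSeries R}
    (h : D = PowerSeries.X * (D * U)) : D = 0 := by
  ext n
  induction n using Nat.strong_induction_on with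
  | _ n ih =>
    rw [h]
    cases n with
    | zero => simp
    | succ n =>
      rw [PowerSeries.coeff_succ_X_mul, PowerSeries.coeff_mul]
      refine Finset.sum_eq_zero fun x hx => ?_
      have := Finset.HasAntidiagonal.mem_antidiagonal.1 hx
      rw [ih x.1 (by omega)]
      simp

theorem convolution_swap {b : R} {a c : ℕ → R} (left : ∀ j, a 0 * b * c j = c j)
    (right : ∀ j, c j * b * a 0 = c j)
    (succ : ∀ j, a (j + 1) = ∑ l ∈ Finset.range (j + 1), a (j - l) * b * c l) (j : ℕ) :
    a (j + 1) = ∑ l ∈ Finset.range (j + 1), c l * b * a (j - l) := by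
  set A := PowerSeries.mk a
  set S := PowerSeries.mk c
  set β := PowerSeries.C (R := R) b
  set κ := PowerSeries.C (R := R) (a 0)
  have hl : κ * β * S = S := by
    ext n
    simp [κ, β, S, ← map_mul, left]
  have hr : S * β * κ = S := by
    ext n
    simp [κ, β, S, right]
  have hA : A = κ + PowerSeries.X * (A * β * S) := by
    ext n
    cases n with
    | zero => simp [A, κ]
    | succ n =>
      rw [map_add, PowerSeries.coeff_succ_X_mul, PowerSeries.coeff_mul,
        ← Finset.Nat.sum_antidiagonal_swap,
        Finset.Nat.sum_antidiagonal_eq_sum_range_succ_mk]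
      simp [A, κ, β, S, succ]
  have hX : ∀ Y : PowerSeries R, Y * PowerSeries.X = PowerSeries.X * Y := fun Y =>
    (PowerSeries.commute_X Y).eq
  have key : A - κ - PowerSeries.X * (S * β * A) =
      PowerSeries.X * ((A - κ - PowerSeries.X * (S * β * A)) * (β * S)) := by
    have h1 : A - κ = PowerSeries.X * (A * β * S) := by
      nth_rw 1 [hA]; abel
    have h2 : S * β * A = S + PowerSeries.X * (S * β * A * β * S) := by
      calc S * β * A = S * β * (κ + PowerSeries.X * (A * β * S)) := by rw [← hA]
        _ = S * β * κ + (S * β * PowerSeries.X) * (A * β * S) := by noncomm_ring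
        _ = S + PowerSeries.X * (S * β * A * β * S) := by
          rw [hr, hX]; simp only [mul_assoc]
    calc _ = PowerSeries.X * (A * β * S) -
          PowerSeries.X * (S + PowerSeries.X * (S * β * A * β * S)) := by rw [h1, ← h2]
      _ = PowerSeries.X * (A * β * S - κ * β * S - PowerSeries.X * (S * β * A * β * S)) := by
          rw [hl, ← mul_sub]; congr 1; abel
      _ = _ := by simp only [sub_mul, mul_assoc]
  have hD := PowerSeries.eq_zero_of_eq_X_mul_mul key
  have := congrArg (PowerSeries.coeff (j + 1)) hD
  rw [map_sub, PowerSeries.coeff_succ_X_mul, PowerSeries.coeff_mul,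
    Finset.Nat.sum_antidiagonal_eq_sum_range_succ_mk] at this
  simpa [A, κ, β, S, PowerSeries.coeff_C, sub_eq_zero] using this

namespace SchurPair

variable {b : R} {a c : ℕ → R}

theorem hankel_shift (h : SchurPair b a c) (j k : ℕ) :
    ∑ l ∈ Finset.range (j + 1), ∑ r ∈ Finset.range (k + 1),
      a (j - l) * b * c (l + r) * b * a (k - r) = a (j + k + 1) := by
  induction j generalizing k with
  | zero =>
    rw [show 0 + k + 1 = k + 1 by omega, h.succ' k]
    simp [h.left]
  | succ j ih =>
    have h1 := ih (k + 1)
    rw [show j + 1 + k + 1 = j + (k + 1) + 1 by omega, ← h1, Finset.sum_range_succ']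
    simp_rw [Finset.sum_range_succ' _ (k + 1)]
    rw [Finset.sum_add_distrib]
    congr 1
    · refine Finset.sum_congr rfl fun l _ => Finset.sum_congr rfl fun r _ => ?_
      rw [show l + 1 + r = l + (r + 1) by omega]
      simp only [Nat.add_sub_add_right]
    · simp only [Nat.sub_zero, Nat.zero_add, Nat.add_zero]
      simp_rw [← Finset.sum_mul, ← h.succ, mul_assoc]
      rw [← Finset.mul_sum, ← Finset.mul_sum]
      simp_rw [← mul_assoc]
      rw [← h.succ', mul_assoc]

theorem hankel (h : SchurPair b a c) (j k : ℕ) :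
    a j * b * a k + ∑ l ∈ Finset.range j, ∑ r ∈ Finset.range k,
      a (j - 1 - l) * b * c (l + r + 1) * b * a (k - 1 - r) = a (j + k) := by
  induction j generalizing k with
  | zero => simp [h.left_seq]
  | succ j ih =>
    rw [show j + 1 + k = j + (k + 1) by omega, ← ih (k + 1), Finset.sum_range_succ']
    simp_rw [Finset.sum_range_succ' _ k]
    rw [Finset.sum_add_distrib]
    have e1 : ∑ r ∈ Finset.range k, a (j + 1 - 1 - 0) * b * c (0 + r + 1) * b * a (k - 1 - r) =
        a j * b * a (k + 1) - a j * b * c 0 * b * a k := by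
      rw [h.succ' k, Finset.sum_range_succ']
      simp only [Nat.zero_add, Nat.sub_zero, Nat.add_sub_cancel, mul_add, Finset.mul_sum,
        mul_assoc, add_sub_cancel_right]
      refine Finset.sum_congr rfl fun r hr => ?_
      rw [show k - 1 - r = k - (r + 1) by omega]
    have e2 : ∑ l ∈ Finset.range j, a (j - 1 - l) * b * c (l + 0 + 1) * b * a (k + 1 - 1 - 0) =
        a (j + 1) * b * a k - a j * b * c 0 * b * a k := by
      rw [h.succ j, Finset.sum_range_succ']
      simp only [Nat.add_zero, Nat.sub_zero, Nat.add_sub_cancel, add_mul, Finset.sum_mul,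
        add_sub_cancel_right]
      refine Finset.sum_congr rfl fun r hr => ?_
      rw [show j - 1 - r = j - (r + 1) by omega]
    rw [e1, e2]
    have e3 : ∑ l ∈ Finset.range j, ∑ r ∈ Finset.range k,
        a (j + 1 - 1 - (l + 1)) * b * c (l + 1 + r + 1) * b * a (k - 1 - r) =
        ∑ l ∈ Finset.range j, ∑ r ∈ Finset.range k,
        a (j - 1 - l) * b * c (l + (r + 1) + 1) * b * a (k + 1 - 1 - (r + 1)) := by
      refine Finset.sum_congr rfl fun l _ => Finset.sum_congr rfl fun r _ => ?_
      rw [show l + 1 + r = l + (r + 1) by omega, show j + 1 - 1 - (l + 1) = j - 1 - l by omega,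
        show k + 1 - 1 - (r + 1) = k - 1 - r by omega]
    rw [e3]
    abel

end SchurPair

/-- The coefficients of `a 0 * a⁻¹` for the formal power series `a` whose Schur transform is `c`. -/
def invCoeff (b p : R) (c : ℕ → R) : ℕ → R
  | 0 => p
  | j + 1 => -(c j * b)

theorem SchurPair.sum_invCoeff_mul {b : R} {a c : ℕ → R} (h : SchurPair b a c) (d : ℕ) :
    ∑ x ∈ Finset.range (d + 1), invCoeff b (a 0 * b) c (d - x) * a x =
      if d = 0 then a 0 else 0 := by
  cases d with
  | zero => simp [invCoeff, h.left_seq]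
  | succ d =>
    rw [Finset.sum_range_succ, Nat.sub_self, invCoeff, h.left_seq, h.succ',
      ← Finset.sum_range_reflect]
    simp only [Nat.add_eq_zero_iff, one_ne_zero, and_false, if_false]
    rw [← Finset.sum_add_distrib]
    refine Finset.sum_eq_zero fun x hx => ?_
    have hx := Finset.mem_range.1 hx
    rw [show d + 1 - (d + 1 - 1 - x) = x + 1 by omega, show d + 1 - 1 - x = d - x by omega]
    simp [invCoeff]

/-- The lower triangular block Toeplitz matrix with symbol `f`. -/
def toeplitz (n : ℕ) (f : ℕ → R) : Matrix (Fin n) (Fin n) R :=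
  Matrix.of fun j l => if l ≤ j then f (j - l) else 0

theorem sum_fin_ite_le {M : Type*} [AddCommMonoid M] {n : ℕ} (j : Fin n) (f : ℕ → M) :
    (∑ l : Fin n, if l ≤ j then f l else 0) = ∑ l ∈ Finset.range (j + 1), f l := by
  have : (∑ l : Fin n, if l ≤ j then f l else 0) =
      ∑ l ∈ Finset.range n, if l ≤ (j : ℕ) then f l else 0 := by
    rw [Finset.sum_range]
    rfl
  rw [this, ← Finset.sum_filter]
  congr 1
  ext l
  simp only [Finset.mem_filter, Finset.mem_range]
  omega

theorem sum_fin_ite_lt {M : Type*} [AddCommMonoid M] {n j : ℕ} (hj : j ≤ n) (f : ℕ → M) :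
    (∑ l : Fin n, if (l : ℕ) < j then f l else 0) = ∑ l ∈ Finset.range j, f l := by
  rw [← Finset.sum_range fun l => if l < j then f l else 0, ← Finset.sum_filter]
  congr 1
  ext l
  simp only [Finset.mem_filter, Finset.mem_range]
  omega

theorem toeplitz_mul (n : ℕ) (f g : ℕ → R) :
    toeplitz n f * toeplitz n g =
      toeplitz n fun d => ∑ x ∈ Finset.range (d + 1), f (d - x) * g x := by
  ext j l
  simp only [toeplitz, Matrix.mul_apply, Matrix.of_apply, ite_mul, zero_mul]
  have h1 := sum_fin_ite_le j fun i => f (j - i) * if (l : ℕ) ≤ i then g (i - l) else 0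
  simp only [Fin.le_def] at h1 ⊢
  rw [h1]
  split_ifs with hlj
  · rw [show (j : ℕ) + 1 = l + (j - l + 1) by omega, Finset.sum_range_add]
    rw [Finset.sum_eq_zero, zero_add]
    · refine Finset.sum_congr rfl fun x _ => ?_
      simp [Nat.sub_sub]
    · intro i hi
      rw [if_neg (by simpa using hi), mul_zero]
  · refine Finset.sum_eq_zero fun i hi => ?_
    rw [if_neg (by have := Finset.mem_range.1 hi; omega), mul_zero]

theorem SchurPair.toeplitz_invCoeff_mul {b : R} {a c : ℕ → R} (h : SchurPair b a c) (n : ℕ) :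
    toeplitz n (invCoeff b (a 0 * b) c) * toeplitz n (fun j => a j * b) =
      Matrix.diagonal fun _ => a 0 * b := by
  rw [toeplitz_mul]
  ext j l
  simp only [toeplitz, Matrix.of_apply, ← mul_assoc, ← Finset.sum_mul, h.sum_invCoeff_mul,
    Matrix.diagonal_apply, Fin.le_def, Fin.ext_iff]
  split_ifs <;> first | rfl | omega | simp

variable {b : R} {a c : ℕ → R}

/-- The symbol `X * a * b`. -/
def shiftedSymbol (b : R) (a : ℕ → R) : ℕ → R
  | 0 => 0
  | j + 1 => a j * b

theorem SchurPair.submatrix_invCoeff_mul_column (h : SchurPair b a c) (n : ℕ) :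
    (toeplitz (n + 1) (invCoeff b (a 0 * b) c)).submatrix (Fin.succ : Fin n → _) id *
      (Matrix.of fun (j : Fin (n + 1)) (_ : Unit) => a j * b) = 0 := by
  ext j u
  simp only [Matrix.mul_apply, Matrix.submatrix_apply, toeplitz, Matrix.of_apply, id, ite_mul,
    zero_mul, Matrix.zero_apply]
  rw [sum_fin_ite_le j.succ fun i => invCoeff b (a 0 * b) c (j.succ - i) * (a i * b)]
  simp only [← mul_assoc, ← Finset.sum_mul]
  simp [h.sum_invCoeff_mul]

theorem SchurPair.submatrix_invCoeff_mul (h : SchurPair b a c) (n : ℕ) :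
    (toeplitz (n + 1) (invCoeff b (a 0 * b) c)).submatrix (Fin.succ : Fin n → _) id *
      (toeplitz (n + 1) (shiftedSymbol b a)).submatrix id Fin.castSucc =
      Matrix.diagonal fun _ => a 0 * b := by
  rw [← Matrix.submatrix_mul _ _ _ _ _ Function.bijective_id, toeplitz_mul]
  ext j l
  simp only [toeplitz, Matrix.submatrix_apply, Matrix.of_apply, Fin.le_def, Fin.val_succ,
    Fin.val_castSucc, Matrix.diagonal_apply, Fin.ext_iff]
  rcases lt_or_ge (j : ℕ) l with hl | hl
  · rw [if_neg (by omega : ¬ (j : ℕ) = l)]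
    split_ifs with h1
    · simp [show (j : ℕ) + 1 - l = 0 by omega, shiftedSymbol]
    · rfl
  · rw [if_pos (by omega), show (j : ℕ) + 1 - l = j - l + 1 by omega, Finset.sum_range_succ']
    simp only [shiftedSymbol, Nat.add_sub_add_right, mul_zero, add_zero, ← mul_assoc,
      ← Finset.sum_mul, h.sum_invCoeff_mul]
    split_ifs <;> first | rfl | omega | simp

section StarRing

variable [StarRing R]

theorem star_mul_eq_of_star_eq (hb : star b = b) (ha : ∀ j, star (a j) = a j) (j : ℕ) :
    star (a j * b) = b * a j := by
  rw [star_mul, hb, ha]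

theorem SchurPair.hankel_shift_eq (h : SchurPair b a c) (hb : star b = b)
    (ha : ∀ j, star (a j) = a j) (n : ℕ) :
    (Matrix.of fun j k : Fin n => a (j + k + 1)) =
      toeplitz n (fun j => a j * b) * (Matrix.of fun j k : Fin n => c (j + k)) *
        (toeplitz n fun j => a j * b)ᴴ := by
  ext j k
  simp only [Matrix.mul_apply, Matrix.of_apply, toeplitz, Matrix.conjTranspose_apply,
    apply_ite star, star_zero, star_mul_eq_of_star_eq hb ha, mul_ite, ite_mul, mul_zero, zero_mul]
  have h1 : ∀ r : Fin n, (∑ l : Fin n, if l ≤ j then a (j - l) * b * c (l + r) else 0) =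
      ∑ l ∈ Finset.range (j + 1), a (j - l) * b * c (l + r) := fun r =>
    sum_fin_ite_le j fun l => a (j - l) * b * c (l + r)
  simp only [h1]
  rw [sum_fin_ite_le k fun r => (∑ l ∈ Finset.range (j + 1), a (j - l) * b * c (l + r)) *
    (b * a (k - r)), ← h.hankel_shift, Finset.sum_comm]
  simp only [Finset.sum_mul, mul_assoc]

theorem SchurPair.diagonal_conj (h : SchurPair b a c) (hb : star b = b)
    (ha : ∀ j, star (a j) = a j) (n : ℕ) (f : Fin n → Fin n → ℕ) :
    (Matrix.diagonal fun _ => a 0 * b) * (Matrix.of fun j k : Fin n => c (f j k)) *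
      (Matrix.diagonal fun _ => a 0 * b)ᴴ = Matrix.of fun j k : Fin n => c (f j k) := by
  ext j k
  simp only [Matrix.diagonal_conjTranspose, Matrix.mul_diagonal, Matrix.diagonal_mul,
    Matrix.of_apply, Pi.star_apply, star_mul_eq_of_star_eq hb ha, h.left]
  rw [← mul_assoc, h.right]

theorem SchurPair.hankel_eq_conj_shift (h : SchurPair b a c) (hb : star b = b)
    (ha : ∀ j, star (a j) = a j) (n : ℕ) :
    (Matrix.of fun j k : Fin n => c (j + k)) =
      toeplitz n (invCoeff b (a 0 * b) c) * (Matrix.of fun j k : Fin n => a (j + k + 1)) *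
        (toeplitz n (invCoeff b (a 0 * b) c))ᴴ := by
  rw [h.hankel_shift_eq hb ha]
  conv_lhs => rw [← h.diagonal_conj hb ha n, ← h.toeplitz_invCoeff_mul, Matrix.conjTranspose_mul]
  simp only [Matrix.mul_assoc]

theorem SchurPair.hankel_eq (h : SchurPair b a c) (hb : star b = b)
    (ha : ∀ j, star (a j) = a j) (n : ℕ) :
    (Matrix.of fun j k : Fin (n + 1) => a (j + k)) =
      (Matrix.of fun (j : Fin (n + 1)) (_ : Unit) => a j * b) *
        (Matrix.of fun _ _ : Unit => a 0) *
        (Matrix.of fun (j : Fin (n + 1)) (_ : Unit) => a j * b)ᴴ +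
      (toeplitz (n + 1) (shiftedSymbol b a)).submatrix id Fin.castSucc *
        (Matrix.of fun j k : Fin n => c (j + k + 1)) *
        ((toeplitz (n + 1) (shiftedSymbol b a)).submatrix id Fin.castSucc)ᴴ := by
  have hT : (toeplitz (n + 1) (shiftedSymbol b a)).submatrix id Fin.castSucc =
      Matrix.of fun (j : Fin (n + 1)) (l : Fin n) =>
        if (l : ℕ) < j then a (j - 1 - l) * b else 0 := by
    ext j l
    simp only [Matrix.submatrix_apply, toeplitz, Matrix.of_apply, Fin.le_def, id,
      Fin.val_castSucc]
    rcases lt_trichotomy (l : ℕ) j with hl | hl | hl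
    · rw [if_pos hl.le, if_pos hl, show (j : ℕ) - l = j - 1 - l + 1 by omega]
      rfl
    · simp [hl, shiftedSymbol]
    · rw [if_neg (by omega), if_neg (by omega)]
  rw [hT]
  ext j k
  simp only [Matrix.add_apply, Matrix.mul_apply, Matrix.of_apply, Matrix.conjTranspose_apply,
    apply_ite star, star_zero, star_mul_eq_of_star_eq hb ha, mul_ite, ite_mul, mul_zero, zero_mul,
    Finset.univ_unique, Finset.sum_singleton]
  have h1 : ∀ r : Fin n,
      (∑ l : Fin n, if (l : ℕ) < j then a (j - 1 - l) * b * c (l + r + 1) else 0) =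
      ∑ l ∈ Finset.range j, a (j - 1 - l) * b * c (l + r + 1) := fun r =>
    sum_fin_ite_lt (Nat.lt_succ_iff.1 j.2) fun l => a (j - 1 - l) * b * c (l + r + 1)
  simp only [h1]
  rw [sum_fin_ite_lt (Nat.lt_succ_iff.1 k.2) fun r =>
    (∑ l ∈ Finset.range j, a (j - 1 - l) * b * c (l + r + 1)) * (b * a (k - 1 - r)),
    ← h.hankel, Finset.sum_comm]
  congr 1
  · rw [mul_assoc (a j) b (a 0), mul_assoc (a j), mul_assoc (a j) (b * a 0),
      ← mul_assoc (b * a 0), h.inner]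
  · simp only [Finset.sum_mul, mul_assoc]

theorem SchurPair.shift_eq_conj_hankel (h : SchurPair b a c) (hb : star b = b)
    (ha : ∀ j, star (a j) = a j) (n : ℕ) :
    (Matrix.of fun j k : Fin n => c (j + k + 1)) =
      (toeplitz (n + 1) (invCoeff b (a 0 * b) c)).submatrix (Fin.succ : Fin n → _) id *
        (Matrix.of fun j k : Fin (n + 1) => a (j + k)) *
        ((toeplitz (n + 1) (invCoeff b (a 0 * b) c)).submatrix (Fin.succ : Fin n → _) id)ᴴ := by
  rw [h.hankel_eq hb ha, Matrix.mul_add, Matrix.add_mul, ← Matrix.mul_assoc, ← Matrix.mul_assoc,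
    h.submatrix_invCoeff_mul_column]
  simp only [Matrix.zero_mul, zero_add]
  conv_lhs => rw [← h.diagonal_conj hb ha n, ← h.submatrix_invCoeff_mul, Matrix.conjTranspose_mul]
  simp only [Matrix.mul_assoc]

end StarRing

end Ring

section MoorePenrose

variable {n : Type*} [Fintype n]

theorem IsMP.unique {m : Type*} [Fintype m] {A : Matrix m n ℂ} {B C : Matrix n m ℂ}
    (hB : IsMP A B) (hC : IsMP A C) : B = C := by
  obtain ⟨b1, b2, b3, b4⟩ := hB
  obtain ⟨c1, c2, c3, c4⟩ := hC
  have h1 : A * B = A * C := by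
    calc A * B = (A * C) * (A * B) := by rw [← Matrix.mul_assoc (A * C), c1]
      _ = ((A * B) * (A * C))ᴴ := by rw [conjTranspose_mul (A * B), b3, c3]
      _ = A * C := by rw [← Matrix.mul_assoc (A * B), b1, c3]
  have h2 : B * A = C * A := by
    calc B * A = (B * A) * (C * A) := by
          rw [Matrix.mul_assoc, ← Matrix.mul_assoc A, c1]
      _ = ((C * A) * (B * A))ᴴ := by rw [conjTranspose_mul (C * A), b4, c4]
      _ = C * A := by rw [Matrix.mul_assoc C, ← Matrix.mul_assoc A, b1, c4]
  calc B = B * A * B := b2.symm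
    _ = C * A * C := by rw [Matrix.mul_assoc, h1, ← Matrix.mul_assoc, h2]
    _ = C := c2

theorem Matrix.IsHermitian.exists_isMP {A : Matrix n n ℂ} (hA : A.IsHermitian) :
    ∃ B, IsMP A B := by
  classical
  set φ := Unitary.conjStarAlgAut ℂ (Matrix n n ℂ) hA.eigenvectorUnitary with hφ
  set D : Matrix n n ℂ := diagonal fun i => (hA.eigenvalues i : ℂ)
  set E : Matrix n n ℂ := diagonal fun i => ((hA.eigenvalues i)⁻¹ : ℂ)
  have hAD : A = φ D := hA.spectral_theorem
  have hDE : D * E * D = D := by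
    simp only [D, E, diagonal_mul_diagonal]
    congr 1; ext i
    exact mul_inv_mul_cancel _
  have hED : E * D * E = E := by
    simp only [D, E, diagonal_mul_diagonal]
    congr 1; ext i
    simpa using mul_inv_mul_cancel ((hA.eigenvalues i : ℂ)⁻¹)
  have hD : star D = D := by
    simp [D, star_eq_conjTranspose, diagonal_conjTranspose, Pi.star_def]
  have hE : star E = E := by
    simp [E, star_eq_conjTranspose, diagonal_conjTranspose, Pi.star_def]
  have hc : D * E = E * D := by
    simp only [D, E, diagonal_mul_diagonal, mul_comm]
  refine ⟨φ E, ?_, ?_, ?_, ?_⟩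
  · rw [hAD, ← map_mul, ← map_mul, hDE]
  · rw [hAD, ← map_mul, ← map_mul, hED]
  · rw [hAD, ← map_mul, ← star_eq_conjTranspose, ← map_star, star_mul, hD, hE, hc]
  · rw [hAD, ← map_mul, ← star_eq_conjTranspose, ← map_star, star_mul, hD, hE, hc]

theorem Matrix.IsHermitian.isMP_mp {A : Matrix n n ℂ} (hA : A.IsHermitian) : IsMP A (mp A) := by
  have h := hA.exists_isMP
  rw [mp, dif_pos h]
  exact h.choose_spec

theorem Matrix.IsHermitian.mp {A : Matrix n n ℂ} (hA : A.IsHermitian) :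
    (_root_.mp A).IsHermitian := by
  obtain ⟨h1, h2, h3, h4⟩ := hA.isMP_mp
  refine IsMP.unique (A := A) ⟨?_, ?_, ?_, ?_⟩ hA.isMP_mp
  · have := congrArg (fun X => Xᴴ) h1
    simpa [conjTranspose_mul, hA.eq, Matrix.mul_assoc] using this
  · have := congrArg (fun X => Xᴴ) h2
    simpa [conjTranspose_mul, hA.eq, Matrix.mul_assoc] using this
  · rw [conjTranspose_mul, conjTranspose_conjTranspose, hA.eq, ← h4, conjTranspose_mul, hA.eq]
  · rw [conjTranspose_mul, conjTranspose_conjTranspose, hA.eq, ← h3, conjTranspose_mul, hA.eq]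

theorem Matrix.IsHermitian.mul_mp_comm {A : Matrix n n ℂ} (hA : A.IsHermitian) :
    A * _root_.mp A = _root_.mp A * A := by
  rw [← hA.isMP_mp.2.2.1, conjTranspose_mul, hA.eq, hA.mp.eq]

theorem Matrix.IsHermitian.isHermitian_mul_mp {A : Matrix n n ℂ} (hA : A.IsHermitian) :
    (A * _root_.mp A)ᴴ = A * _root_.mp A :=
  hA.isMP_mp.2.2.1

theorem Matrix.IsHermitian.ker_le_iff {A S : Matrix n n ℂ} (hA : A.IsHermitian) :
    LinearMap.ker A.mulVecLin ≤ LinearMap.ker S.mulVecLin ↔ S * _root_.mp A * A = S := by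
  classical
  constructor
  · intro h
    have key : S * (1 - _root_.mp A * A) = 0 := by
      ext i j
      have h1 : A *ᵥ ((1 - _root_.mp A * A) *ᵥ Pi.single j 1) = 0 := by
        rw [mulVec_mulVec, mul_sub, ← Matrix.mul_assoc, hA.isMP_mp.1, mul_one, sub_self,
          zero_mulVec]
      have h2 : S *ᵥ ((1 - _root_.mp A * A) *ᵥ Pi.single j 1) = 0 := h h1
      rw [mulVec_mulVec, mulVec_single_one] at h2
      exact congrFun h2 i
    rw [mul_sub, mul_one, sub_eq_zero] at key
    rw [Matrix.mul_assoc, ← key]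
  · intro h v hv
    have hv : A *ᵥ v = 0 := hv
    show S *ᵥ v = 0
    rw [← h, ← mulVec_mulVec, hv, mulVec_zero]

end MoorePenrose

section Block

theorem Matrix.comp_mul_mul_conjTranspose {ι κ n : Type*} [Fintype ι] [Fintype κ] [Fintype n]
    (L : Matrix κ ι (Matrix n n ℂ)) (G : Matrix ι ι (Matrix n n ℂ)) :
    comp _ _ _ _ ℂ (L * G * Lᴴ) =
      comp _ _ _ _ ℂ L * comp _ _ _ _ ℂ G * (comp _ _ _ _ ℂ L)ᴴ := by
  ext ⟨i, a⟩ ⟨j, b⟩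
  simp only [comp_apply, mul_apply, conjTranspose_apply, Fintype.sum_prod_type, Matrix.sum_apply,
    star_eq_conjTranspose]

theorem Matrix.PosSemidef.comp_mul_mul_conjTranspose {ι κ n : Type*} [Fintype ι] [Fintype κ]
    [Fintype n] {G : Matrix ι ι (Matrix n n ℂ)} (hG : (comp _ _ _ _ ℂ G).PosSemidef)
    (L : Matrix κ ι (Matrix n n ℂ)) : (comp _ _ _ _ ℂ (L * G * Lᴴ)).PosSemidef := by
  rw [Matrix.comp_mul_mul_conjTranspose]
  exact hG.mul_mul_conjTranspose_same _

/-- A zero diagonal block of a positive semidefinite block matrix annihilates its column. -/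
theorem Matrix.PosSemidef.mulVec_block_eq_zero {ι n : Type*} [Fintype ι] [Fintype n]
    {G : Matrix ι ι (Matrix n n ℂ)} (hG : (comp _ _ _ _ ℂ G).PosSemidef) {i : ι} {v : n → ℂ}
    (hv : G i i *ᵥ v = 0) (l : ι) : G l i *ᵥ v = 0 := by
  classical
  set x : ι × n → ℂ := fun y => if y.1 = i then v y.2 else 0
  have hx : ∀ l a, (comp _ _ _ _ ℂ G *ᵥ x) (l, a) = (G l i *ᵥ v) a := by
    intro l a
    simp [mulVec, dotProduct, Fintype.sum_prod_type, x, comp_apply]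
  have h0 : star x ⬝ᵥ (comp _ _ _ _ ℂ G *ᵥ x) = 0 := by
    rw [dotProduct, Fintype.sum_prod_type]
    refine Finset.sum_eq_zero fun j _ => Finset.sum_eq_zero fun a _ => ?_
    rw [hx]
    by_cases hj : j = i
    · subst hj
      rw [hv]
      simp
    · simp [x, hj]
  have h1 := (hG.dotProduct_mulVec_zero_iff x).1 h0
  funext a
  rw [← hx, h1]
  rfl

end Block

section Stieltjes

variable {q : ℕ} {α : ℝ}

theorem kgg_iff {κ : ℕ∞} {s : ℕ → Matrix (Fin q) (Fin q) ℂ} :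
    Kgg α κ s ↔
      (∀ n : ℕ, ((2 * n : ℕ) : ℕ∞) ≤ κ →
        (comp _ _ _ _ ℂ (of fun j k : Fin (n + 1) => s (j + k))).PosSemidef) ∧
      (∀ n : ℕ, ((2 * n + 1 : ℕ) : ℕ∞) ≤ κ →
        (comp _ _ _ _ ℂ (of fun j k : Fin (n + 1) =>
          shiftA (α : ℂ) s (j + k + 1))).PosSemidef) :=
  Iff.rfl

theorem Kgg.congr {M : ℕ} {s t : ℕ → Matrix (Fin q) (Fin q) ℂ} (hs : Kgg α M s)
    (h : ∀ j ≤ M, s j = t j) : Kgg α M t := by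
  rw [kgg_iff] at hs ⊢
  refine ⟨fun n hn => ?_, fun n hn => ?_⟩
  · convert hs.1 n hn using 2
    ext1 j k
    have := Nat.cast_le.1 hn
    exact (h _ (by omega)).symm
  · convert hs.2 n hn using 2
    ext1 j k
    have := Nat.cast_le.1 hn
    simp only [of_apply, shiftA]
    rw [h _ (by omega), h _ (by omega)]

theorem Kgg.isHermitian {M : ℕ} {s : ℕ → Matrix (Fin q) (Fin q) ℂ} (hs : Kgg α M s) {j : ℕ}
    (hj : j ≤ M) : (s j).IsHermitian := by
  have heven : ∀ n, 2 * n ≤ M → (s (2 * n)).IsHermitian := by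
    intro n hn
    have h := ((hs.1 n (by exact_mod_cast hn)).1.submatrix fun a : Fin q => (Fin.last n, a))
    rw [two_mul]
    exact h
  obtain ⟨n, rfl | rfl⟩ := Nat.even_or_odd' j
  · exact heven n hj
  · have h := (((kgg_iff.1 hs).2 n (by exact_mod_cast hj)).1.submatrix
      fun a : Fin q => (Fin.last n, a))
    have h : (shiftA (α : ℂ) s (n + n + 1)).IsHermitian := h
    rw [← two_mul, shiftA] at h
    have h2 : ((α : ℂ) • s (2 * n)).IsHermitian := by
      have := heven n (by omega)
      rw [IsHermitian, conjTranspose_smul, this.eq]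
      simp
    have := h.add h2
    rwa [neg_smul, add_assoc, add_comm, add_assoc, add_neg_cancel, add_zero] at this

theorem Kgg.posSemidef_zero {κ : ℕ∞} {s : ℕ → Matrix (Fin q) (Fin q) ℂ} (hs : Kgg α κ s) :
    (s 0).PosSemidef :=
  (hs.1 0 (by simp)).submatrix fun a : Fin q => ((0 : Fin 1), a)

theorem Kgg.ker_le {M : ℕ} {s : ℕ → Matrix (Fin q) (Fin q) ℂ} (hs : Kgg α M s) {j : ℕ}
    (hj : j < M) : LinearMap.ker (s 0).mulVecLin ≤ LinearMap.ker (s j).mulVecLin := by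
  intro v hv
  have hv : s 0 *ᵥ v = 0 := hv
  show s j *ᵥ v = 0
  rw [kgg_iff] at hs
  induction j using Nat.strong_induction_on with
  | _ j ih =>
    rcases Nat.eq_zero_or_pos j with rfl | hpos
    · exact hv
    obtain ⟨i, rfl | rfl⟩ : ∃ i, j = 2 * i + 1 ∨ j = 2 * i + 2 := ⟨(j - 1) / 2, by omega⟩
    · have h := (hs.1 (i + 1) (by norm_cast)).mulVec_block_eq_zero
        (i := ⟨i, by omega⟩) (v := v) ?_ ⟨i + 1, by omega⟩
      · simpa [show i + 1 + i = 2 * i + 1 by omega] using h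
      · simpa [← two_mul] using ih (2 * i) (by omega) (by omega)
    · have h := (hs.2 (i + 1) (by norm_cast)).mulVec_block_eq_zero
        (i := ⟨i, by omega⟩) (v := v) ?_ ⟨i + 1, by omega⟩
      · simpa [show i + 1 + i = 2 * i + 1 by omega, shiftA, add_mulVec, neg_mulVec, smul_mulVec,
          ih (2 * i + 1) (by omega) (by omega)] using h
      · simp [← two_mul, shiftA, add_mulVec, neg_mulVec, smul_mulVec,
          ih (2 * i + 1) (by omega) (by omega), ih (2 * i) (by omega) (by omega)]

end Stieltjes

section Transform

variable {q : ℕ} {α : ℝ}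

/-- The sequence `p * s j * p`, cut off after the index `N`. -/
noncomputable def compress (p : Matrix (Fin q) (Fin q) ℂ) (N : ℕ)
    (s : ℕ → Matrix (Fin q) (Fin q) ℂ) (j : ℕ) : Matrix (Fin q) (Fin q) ℂ :=
  if j ≤ N then p * s j * p else 0

theorem mul_shiftA_mul (z : ℂ) (p : Matrix (Fin q) (Fin q) ℂ)
    (s : ℕ → Matrix (Fin q) (Fin q) ℂ) (j : ℕ) :
    shiftA z (fun j => p * s j * p) j = p * shiftA z s j * p := by
  cases j <;> simp [shiftA, mul_add, add_mul]

theorem Kgg.compress {N : ℕ} {s : ℕ → Matrix (Fin q) (Fin q) ℂ} (hs : Kgg α N s)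
    {p : Matrix (Fin q) (Fin q) ℂ} (hp : pᴴ = p) : Kgg α N (compress p N s) := by
  refine Kgg.congr (s := fun j => p * s j * p) ?_ fun j hj => by simp [_root_.compress, hj]
  have key : ∀ (n : ℕ) (G : Matrix (Fin n) (Fin n) (Matrix (Fin q) (Fin q) ℂ)),
      (comp _ _ _ _ ℂ G).PosSemidef →
      (comp _ _ _ _ ℂ (of fun j k => p * G j k * p)).PosSemidef := by
    intro n G hG
    convert hG.comp_mul_mul_conjTranspose (diagonal fun _ => p) using 2
    ext1 j k
    simp [diagonal_conjTranspose, star_eq_conjTranspose, hp, Pi.star_def]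
  rw [kgg_iff] at hs ⊢
  refine ⟨fun n hn => key _ _ (hs.1 n hn), fun n hn => ?_⟩
  simp only [mul_shiftA_mul]
  exact key _ _ (hs.2 n hn)

theorem isHermitian_compress {N : ℕ} {s : ℕ → Matrix (Fin q) (Fin q) ℂ}
    {p : Matrix (Fin q) (Fin q) ℂ} (hp : pᴴ = p) (hs : ∀ j ≤ N, (s j).IsHermitian) (j : ℕ) :
    (compress p N s j).IsHermitian := by
  rw [compress]
  split_ifs with hj
  · rw [IsHermitian, conjTranspose_mul, conjTranspose_mul, hp, (hs j hj).eq, Matrix.mul_assoc]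
  · exact isHermitian_zero

theorem mul_compress {N : ℕ} {s : ℕ → Matrix (Fin q) (Fin q) ℂ}
    {p : Matrix (Fin q) (Fin q) ℂ} (hp : p * p = p) (j : ℕ) :
    p * compress p N s j = compress p N s j := by
  rw [compress]
  split_ifs
  · rw [← Matrix.mul_assoc, ← Matrix.mul_assoc, hp]
  · simp

theorem compress_mul {N : ℕ} {s : ℕ → Matrix (Fin q) (Fin q) ℂ}
    {p : Matrix (Fin q) (Fin q) ℂ} (hp : p * p = p) (j : ℕ) :
    compress p N s j * p = compress p N s j := by
  rw [compress]
  split_ifs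
  · rw [Matrix.mul_assoc, hp]
  · simp

theorem recip_succ (s : ℕ → Matrix (Fin q) (Fin q) ℂ) (j : ℕ) :
    recip s (j + 1) =
      -(mp (s 0) * ∑ l ∈ Finset.range (j + 1), s (j + 1 - l) * recip s l) := by
  rw [recip, Finset.sum_range]

theorem mp_mul_recip {s : ℕ → Matrix (Fin q) (Fin q) ℂ} (h : IsMP (s 0) (mp (s 0))) (j : ℕ) :
    mp (s 0) * s 0 * recip s j = recip s j := by
  cases j with
  | zero => rw [recip, h.2.1]
  | succ j => rw [recip_succ, Matrix.mul_neg, ← Matrix.mul_assoc, h.2.1]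

theorem recip_congr {s t : ℕ → Matrix (Fin q) (Fin q) ℂ} (h : IsMP (s 0) (mp (s 0)))
    (h0 : s 0 = t 0) {N : ℕ}
    (hst : ∀ j ≤ N, mp (s 0) * s j * mp (s 0) = mp (s 0) * t j * mp (s 0)) {j : ℕ}
    (hj : j ≤ N) : recip s j = recip t j := by
  induction j using Nat.strong_induction_on with
  | _ j ih =>
    cases j with
    | zero => rw [recip, recip, h0]
    | succ j =>
      rw [recip_succ, recip_succ, ← h0, Finset.mul_sum, Finset.mul_sum]
      congr 1
      refine Finset.sum_congr rfl fun l hl => ?_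
      have hl := Finset.mem_range.1 hl
      rw [← ih l hl (by omega), ← mp_mul_recip h l]
      simp only [← Matrix.mul_assoc]
      rw [hst _ (by omega)]

theorem schurPair_schur1 {s : ℕ → Matrix (Fin q) (Fin q) ℂ} (z : ℂ)
    (h : IsMP (s 0) (mp (s 0))) (hl : ∀ j, s 0 * mp (s 0) * s j = s j)
    (hr : ∀ j, s j * mp (s 0) * s 0 = s j) :
    SchurPair (mp (s 0)) (shiftA z s) (schur1 z s) := by
  have hl' : ∀ j, s 0 * mp (s 0) * shiftA z s j = shiftA z s j := by
    intro j
    cases j <;> simp [shiftA, mul_add, hl]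
  have hr' : ∀ j, shiftA z s j * mp (s 0) * s 0 = shiftA z s j := by
    intro j
    cases j <;> simp [shiftA, add_mul, hr]
  have hcl : ∀ j, s 0 * mp (s 0) * schur1 z s j = schur1 z s j := by
    intro j
    rw [schur1, ← Matrix.mul_assoc, ← Matrix.mul_assoc, h.1]
  have hcr : ∀ j, schur1 z s j * mp (s 0) * s 0 = schur1 z s j := by
    intro j
    rw [schur1, Matrix.mul_assoc, Matrix.mul_assoc, ← Matrix.mul_assoc (s 0), h.1]
  have h' : IsMP (shiftA z s 0) (mp (shiftA z s 0)) := h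
  have hsucc : ∀ j, shiftA z s (j + 1) =
      ∑ l ∈ Finset.range (j + 1), shiftA z s (j - l) * mp (s 0) * schur1 z s l := by
    intro j
    have h1 : ∀ l, recipA z s (l + 1) * s 0 = -(mp (s 0) * schur1 z s l) := by
      intro l
      have := mp_mul_recip h' (l + 1)
      rw [schur1, Matrix.mul_neg, Matrix.neg_mul, Matrix.mul_neg, neg_neg]
      nth_rw 1 [recipA, ← this]
      simp only [Matrix.mul_assoc]
      rfl
    have h2 : schur1 z s j =
        ∑ l ∈ Finset.range (j + 1), shiftA z s (j + 1 - l) * (recipA z s l * s 0) := by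
      rw [schur1, recipA, recip_succ, neg_neg, ← Matrix.mul_assoc, Finset.mul_sum,
        Finset.sum_mul]
      refine Finset.sum_congr rfl fun l _ => ?_
      rw [← Matrix.mul_assoc, Matrix.mul_assoc _ _ (s 0)]
      congr 1
      exact hl' _
    rw [Finset.sum_range_succ'] at h2
    have h3 : shiftA z s (j + 1) * (recipA z s 0 * s 0) = shiftA z s (j + 1) := by
      rw [← Matrix.mul_assoc, recipA, recip]
      exact hr' _
    rw [Nat.sub_zero, h3] at h2
    rw [Finset.sum_range_succ, Nat.sub_self, show shiftA z s 0 = s 0 from rfl, hcl, h2,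
      ← add_assoc, ← Finset.sum_add_distrib, Finset.sum_eq_zero, zero_add]
    intro l _
    rw [h1, Nat.add_sub_add_right, Matrix.mul_neg, Matrix.mul_assoc, add_neg_cancel]
  exact ⟨h.2.1, hl', hr', hcl, hcr, hsucc, convolution_swap hcl hcr hsucc⟩

theorem SchurPair.exists_unshift {b : Matrix (Fin q) (Fin q) ℂ}
    {s c : ℕ → Matrix (Fin q) (Fin q) ℂ} {z : ℂ} (h : SchurPair b (shiftA z s) c) :
    ∃ d, SchurPair b s d ∧ ∀ j, d (j + 1) = shiftA z c (j + 1) := by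
  have h0 : shiftA z s 0 = s 0 := rfl
  have hstep : ∀ j, s (j + 1) = z • s j + shiftA z s (j + 1) := by
    intro j; simp [shiftA]
  have hl : ∀ j, s 0 * b * s j = s j := by
    intro j
    induction j with
    | zero => exact h.left_seq 0
    | succ j ih => rw [hstep, mul_add, Matrix.mul_smul, ih, ← h0, h.left_seq]
  have hr : ∀ j, s j * b * s 0 = s j := by
    intro j
    induction j with
    | zero => exact h.right_seq 0
    | succ j ih =>
      rw [hstep, add_mul, add_mul, Matrix.smul_mul, Matrix.smul_mul, ih, ← h0, h.right_seq]
  set d : ℕ → Matrix (Fin q) (Fin q) ℂ := fun j =>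
    if j = 0 then z • s 0 + c 0 else shiftA z c j with hd
  have hd0 : d 0 = z • s 0 + c 0 := rfl
  have hd1 : ∀ j, d (j + 1) = shiftA z c (j + 1) := fun j => rfl
  have hcl : ∀ j, s 0 * b * c j = c j := h.left
  have hcr : ∀ j, c j * b * s 0 = c j := h.right
  have hdl : ∀ j, s 0 * b * d j = d j := by
    intro j
    cases j with
    | zero => rw [hd0, mul_add, Matrix.mul_smul, hl, hcl]
    | succ j => rw [hd1, shiftA, mul_add, Matrix.mul_smul, hcl, hcl]
  have hdr : ∀ j, d j * b * s 0 = d j := by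
    intro j
    cases j with
    | zero => rw [hd0, add_mul, add_mul, Matrix.smul_mul, Matrix.smul_mul, hr, hcr]
    | succ j => rw [hd1, shiftA, add_mul, add_mul, Matrix.smul_mul, Matrix.smul_mul, hcr, hcr]
  have hsucc : ∀ j, s (j + 1) = ∑ l ∈ Finset.range (j + 1), s (j - l) * b * d l := by
    intro j
    have e1 : shiftA z s (j + 1) = ∑ l ∈ Finset.range (j + 1), s (j - l) * b * c l -
        z • ∑ l ∈ Finset.range j, s (j - 1 - l) * b * c l := by
      rw [h.succ, Finset.sum_range_succ, Finset.sum_range_succ, Finset.smul_sum,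
        add_sub_right_comm, ← Finset.sum_sub_distrib, Nat.sub_self, h0]
      congr 1
      refine Finset.sum_congr rfl fun l hl => ?_
      have hl := Finset.mem_range.1 hl
      obtain ⟨i, hi⟩ : ∃ i, j - l = i + 1 := ⟨j - l - 1, by omega⟩
      rw [hi, show j - 1 - l = i by omega, shiftA]
      simp only [add_mul, Matrix.smul_mul, neg_smul, neg_mul]
      abel
    rw [hstep, e1, Finset.sum_range_succ', Finset.sum_range_succ' (fun l => s (j - l) * b * d l),
      Nat.sub_zero, hd0, mul_add, Matrix.mul_smul, hr]
    have e2 : ∑ l ∈ Finset.range j, s (j - (l + 1)) * b * d (l + 1) =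
        ∑ l ∈ Finset.range j, s (j - (l + 1)) * b * c (l + 1) -
        z • ∑ l ∈ Finset.range j, s (j - 1 - l) * b * c l := by
      rw [Finset.smul_sum, ← Finset.sum_sub_distrib]
      refine Finset.sum_congr rfl fun l _ => ?_
      rw [hd1, shiftA, mul_add, Matrix.mul_smul, show j - (l + 1) = j - 1 - l by omega, neg_smul]
      abel
    rw [e2]
    abel
  exact ⟨d, ⟨h.inner, hl, hr, hdl, hdr, hsucc, convolution_swap hdl hdr hsucc⟩, hd1⟩

theorem SchurPair.kgg_iff {b : Matrix (Fin q) (Fin q) ℂ} {s c : ℕ → Matrix (Fin q) (Fin q) ℂ}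
    (h : SchurPair b (shiftA (α : ℂ) s) c) (hb : bᴴ = b) (hs : ∀ j, (s j).IsHermitian)
    (h0 : (s 0).PosSemidef) {M : ℕ} : Kgg α (M + 1 : ℕ) s ↔ Kgg α M c := by
  obtain ⟨d, hd, hdc⟩ := h.exists_unshift
  have ha : ∀ j, star (shiftA (α : ℂ) s j) = shiftA (α : ℂ) s j := by
    intro j
    cases j with
    | zero => exact hs 0
    | succ j =>
      simp only [shiftA, star_eq_conjTranspose, conjTranspose_add, conjTranspose_smul,
        (hs _).eq]
      simp
  rw [_root_.kgg_iff, _root_.kgg_iff]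
  simp only [Nat.cast_le]
  constructor
  · rintro ⟨h1, h2⟩
    refine ⟨fun n hn => ?_, fun n hn => ?_⟩
    · rw [h.hankel_eq_conj_shift hb ha]
      exact (h2 n (by omega)).comp_mul_mul_conjTranspose _
    · simp only [← hdc]
      rw [hd.shift_eq_conj_hankel hb hs]
      exact (h1 (n + 1) (by omega)).comp_mul_mul_conjTranspose _
  · rintro ⟨h1, h2⟩
    refine ⟨fun n hn => ?_, fun n hn => ?_⟩
    · rw [hd.hankel_eq hb hs]
      refine PosSemidef.add (PosSemidef.comp_mul_mul_conjTranspose ?_ _)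
        (PosSemidef.comp_mul_mul_conjTranspose ?_ _)
      · exact h0.submatrix fun x : Unit × Fin q => x.2
      · cases n with
        | zero =>
          convert PosSemidef.zero
          ext x
          exact x.1.elim0
        | succ n =>
          simp only [hdc]
          exact h2 n (by omega)
    · rw [h.hankel_shift_eq hb ha]
      exact (h1 n (by omega)).comp_mul_mul_conjTranspose _

end Transform

section Extension

variable {q : ℕ} {α : ℝ}

theorem Matrix.IsHermitian.mul_mp_mul_mul_mp {A : Matrix (Fin q) (Fin q) ℂ}
    (hA : A.IsHermitian) : A * _root_.mp A * (A * _root_.mp A) = A * _root_.mp A := by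
  rw [← Matrix.mul_assoc, hA.isMP_mp.1]

theorem compress_mul_mp_zero {N : ℕ} {s : ℕ → Matrix (Fin q) (Fin q) ℂ}
    (h0 : (s 0).IsHermitian) : compress (s 0 * mp (s 0)) N s 0 = s 0 := by
  rw [compress, if_pos (Nat.zero_le _), h0.isMP_mp.1, h0.mul_mp_comm, ← Matrix.mul_assoc,
    h0.isMP_mp.1]

theorem schurPair_compress {N : ℕ} {s : ℕ → Matrix (Fin q) (Fin q) ℂ} (z : ℂ)
    (h0 : (s 0).IsHermitian) :
    SchurPair (mp (s 0)) (shiftA z (compress (s 0 * mp (s 0)) N s))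
      (schur1 z (compress (s 0 * mp (s 0)) N s)) := by
  have h := compress_mul_mp_zero (N := N) h0
  have key := schurPair_schur1 (s := compress (s 0 * mp (s 0)) N s) z
  rw [h] at key
  refine key h0.isMP_mp (mul_compress h0.mul_mp_mul_mul_mp) fun j => ?_
  rw [Matrix.mul_assoc, ← h0.mul_mp_comm, compress_mul h0.mul_mp_mul_mul_mp]

theorem schur1_compress {N : ℕ} {s : ℕ → Matrix (Fin q) (Fin q) ℂ} (z : ℂ)
    (h0 : (s 0).IsHermitian) {j : ℕ} (hj : j < N) :
    schur1 z (compress (s 0 * mp (s 0)) N s) j = schur1 z s j := by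
  have h := compress_mul_mp_zero (N := N) h0
  have hmp := h0.isMP_mp
  have hx : ∀ x, mp (s 0) * x * mp (s 0) =
      mp (s 0) * (s 0 * mp (s 0) * x * (s 0 * mp (s 0))) * mp (s 0) := by
    intro x
    have h1 : s 0 * mp (s 0) * mp (s 0) = mp (s 0) := by rw [h0.mul_mp_comm, hmp.2.1]
    have h2 : mp (s 0) * (s 0 * mp (s 0)) = mp (s 0) := by rw [← Matrix.mul_assoc, hmp.2.1]
    rw [← Matrix.mul_assoc, ← Matrix.mul_assoc (mp (s 0)) _ x, h2,
      Matrix.mul_assoc (mp (s 0) * x) (s 0 * mp (s 0)) (mp (s 0)), h1]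
  have hc : ∀ i ≤ N, mp (s 0) * s i * mp (s 0) =
      mp (s 0) * compress (s 0 * mp (s 0)) N s i * mp (s 0) := by
    intro i hi
    rw [compress, if_pos hi, hx]
  rw [schur1, schur1, h, recipA, recipA]
  congr 3
  symm
  refine recip_congr (s := shiftA z s) (t := shiftA z (compress (s 0 * mp (s 0)) N s)) (N := N)
    hmp h.symm (fun i hi => ?_) hj
  cases i with
  | zero => exact hc 0 hi
  | succ i =>
    simp only [shiftA, mul_add, add_mul, Matrix.mul_smul, Matrix.smul_mul]
    rw [hc i (by omega), hc (i + 1) hi]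

theorem Kgg.schur1 {N : ℕ} {s : ℕ → Matrix (Fin q) (Fin q) ℂ} (hs : Kgg α (N + 1 : ℕ) s) :
    Kgg α N (schur1 (α : ℂ) s) := by
  have h0 := hs.isHermitian (Nat.zero_le _)
  have hp := h0.isHermitian_mul_mp
  refine Kgg.congr (((schurPair_compress (N := N + 1) (α : ℂ) h0).kgg_iff h0.mp
    (isHermitian_compress hp fun j hj => hs.isHermitian hj) ?_).1 (hs.compress hp))
    fun j hj => schur1_compress _ h0 (by omega)
  rw [compress_mul_mp_zero h0]
  exact hs.posSemidef_zero

/-- The sequence starting at `a` whose Schur transform with respect to `b` is `c`. -/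
noncomputable def invSchur {R : Type*} [Ring R] (a b : R) (c : ℕ → R) : ℕ → R
  | 0 => a
  | j + 1 => ∑ l : Fin (j + 1), invSchur a b c (j - l) * b * c l
termination_by j => j
decreasing_by omega

theorem invSchur_succ {R : Type*} [Ring R] (a b : R) (c : ℕ → R) (j : ℕ) :
    invSchur a b c (j + 1) =
      ∑ l ∈ Finset.range (j + 1), invSchur a b c (j - l) * b * c l := by
  rw [invSchur, Finset.sum_range]

theorem schurPair_invSchur {R : Type*} [Ring R] {a b : R} {c : ℕ → R} (hb : b * a * b = b)
    (ha : a * b * a = a) (hl : ∀ j, a * b * c j = c j) (hr : ∀ j, c j * b * a = c j) :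
    SchurPair b (invSchur a b c) c := by
  have h0 : invSchur a b c 0 = a := by rw [invSchur]
  have hsucc := invSchur_succ a b c
  have hl' : ∀ j, invSchur a b c 0 * b * c j = c j := by rwa [h0]
  have hr' : ∀ j, c j * b * invSchur a b c 0 = c j := by rwa [h0]
  have hsucc' := convolution_swap hl' hr' hsucc
  refine ⟨by rwa [h0], fun j => ?_, fun j => ?_, hl', hr', hsucc, hsucc'⟩
  · cases j with
    | zero => rw [h0, ha]
    | succ j =>
      rw [hsucc', Finset.mul_sum]
      exact Finset.sum_congr rfl fun l _ => by rw [← mul_assoc, ← mul_assoc, hl']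
  · cases j with
    | zero => rw [h0, ha]
    | succ j =>
      rw [hsucc, Finset.sum_mul, Finset.sum_mul]
      exact Finset.sum_congr rfl fun l _ => by
        rw [mul_assoc, mul_assoc, ← mul_assoc (c l), hr']

theorem star_invSchur {R : Type*} [Ring R] [StarRing R] {a b : R} {c : ℕ → R}
    (h : SchurPair b (invSchur a b c) c) (ha : star a = a) (hb : star b = b)
    (hc : ∀ j, star (c j) = c j) (j : ℕ) : star (invSchur a b c j) = invSchur a b c j := by
  induction j using Nat.strong_induction_on with
  | _ j ih =>
    cases j with
    | zero => rw [invSchur, ha]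
    | succ j =>
      rw [h.succ, star_sum, ← h.succ, h.succ']
      refine Finset.sum_congr rfl fun l hl => ?_
      rw [star_mul, star_mul, hb, hc, ih (j - l) (by omega), mul_assoc]

/-- Inverse of `shiftA`. -/
noncomputable def unshiftA (z : ℂ) (a : ℕ → Matrix (Fin q) (Fin q) ℂ) :
    ℕ → Matrix (Fin q) (Fin q) ℂ
  | 0 => a 0
  | j + 1 => z • unshiftA z a j + a (j + 1)

theorem shiftA_unshiftA (z : ℂ) (a : ℕ → Matrix (Fin q) (Fin q) ℂ) :
    shiftA z (unshiftA z a) = a := by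
  funext j
  cases j <;> simp [shiftA, unshiftA]

theorem unshiftA_shiftA (z : ℂ) (s : ℕ → Matrix (Fin q) (Fin q) ℂ) :
    unshiftA z (shiftA z s) = s := by
  funext j
  induction j with
  | zero => rfl
  | succ j ih => simp [shiftA, unshiftA, ih]

theorem unshiftA_congr {z : ℂ} {a b : ℕ → Matrix (Fin q) (Fin q) ℂ} {j : ℕ}
    (h : ∀ i ≤ j, a i = b i) : unshiftA z a j = unshiftA z b j := by
  induction j with
  | zero => exact h 0 le_rfl
  | succ j ih => rw [unshiftA, unshiftA, ih fun i hi => h i (by omega), h _ le_rfl]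

theorem SchurPair.invSchur_eq {R : Type*} [Ring R] {b : R} {a c d : ℕ → R}
    (h : SchurPair b a c) {j : ℕ} (hcd : ∀ i < j, c i = d i) : invSchur (a 0) b d j = a j := by
  induction j using Nat.strong_induction_on with
  | _ j ih =>
    cases j with
    | zero => rw [invSchur]
    | succ j =>
      rw [invSchur_succ, h.succ]
      refine Finset.sum_congr rfl fun l hl => ?_
      rw [ih (j - l) (by omega) fun i hi => hcd i (by omega),
        hcd l (Finset.mem_range.1 hl)]

theorem Kgg.exists_extension_of_schur1 {m : ℕ} {s u : ℕ → Matrix (Fin q) (Fin q) ℂ}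
    (hs : Kgg α (m + 1 : ℕ) s)
    (hker : LinearMap.ker (s 0).mulVecLin ≤ LinearMap.ker (s (m + 1)).mulVecLin)
    (hu : Kgg α (m + 1 : ℕ) u) (hus : ∀ j ≤ m, u j = _root_.schur1 (α : ℂ) s j) :
    ∃ t, (∀ j ≤ m + 1, t j = s j) ∧ Kgg α (m + 1 + 1 : ℕ) t := by
  have h0 := hs.isHermitian (Nat.zero_le _)
  have hp := h0.isHermitian_mul_mp
  have hpp := h0.mul_mp_mul_mul_mp
  set b := mp (s 0) with hb
  have hcompress : ∀ j ≤ m + 1, _root_.compress (s 0 * b) (m + 1) s j = s j := by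
    intro j hj
    have h1 : s j * (s 0 * b) = s j := by
      have : s j * b * s 0 = s j := by
        refine h0.ker_le_iff.1 ?_
        rcases hj.lt_or_eq with hj | rfl
        · exact hs.ker_le hj
        · exact hker
      rwa [h0.mul_mp_comm, ← Matrix.mul_assoc]
    have h2 : s 0 * b * s j = s j := by
      have := congrArg (fun X => Xᴴ) h1
      simpa only [conjTranspose_mul (s j), hp, (hs.isHermitian hj).eq] using this
    rw [_root_.compress, if_pos hj, h2, h1]
  set w := _root_.compress (s 0 * b) (m + 1) u
  have hw : Kgg α (m + 1 : ℕ) w := hu.compress hp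
  have hwH : ∀ j, (w j).IsHermitian :=
    isHermitian_compress hp fun j hj => hu.isHermitian hj
  have hpair : SchurPair b (invSchur (s 0) b w) w := by
    refine schurPair_invSchur h0.isMP_mp.2.1 h0.isMP_mp.1 (mul_compress hpp) fun j => ?_
    rw [Matrix.mul_assoc, ← h0.mul_mp_comm, compress_mul hpp]
  have hcs := schurPair_compress (N := m + 1) (α : ℂ) h0
  have hws : ∀ j ≤ m, _root_.schur1 (α : ℂ) (_root_.compress (s 0 * b) (m + 1) s) j = w j := by
    intro j hj
    have h1 := hcs.left j
    have h2 := hcs.right j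
    rw [show shiftA (α : ℂ) (_root_.compress (s 0 * mp (s 0)) (m + 1) s) 0 = s 0 from
      compress_mul_mp_zero h0] at h1 h2
    rw [Matrix.mul_assoc, ← h0.mul_mp_comm] at h2
    have hv := schur1_compress (N := m + 1) (α : ℂ) h0 (Nat.lt_succ_of_le hj)
    rw [hv] at h1 h2 ⊢
    simp only [w, _root_.compress]
    rw [if_pos (by omega), hus j hj, h1, h2]
  have hpair' : SchurPair b (shiftA (α : ℂ) (unshiftA α (invSchur (s 0) b w))) w := by
    rwa [shiftA_unshiftA]
  have hH : ∀ j, (unshiftA (α : ℂ) (invSchur (s 0) b w) j).IsHermitian := by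
    have hi := star_invSchur hpair h0 h0.mp hwH
    intro j
    induction j with
    | zero => exact hi 0
    | succ j ih =>
      rw [unshiftA, IsHermitian, conjTranspose_add, conjTranspose_smul, ih.eq,
        ← star_eq_conjTranspose (invSchur _ _ _ _), hi]
      simp
  refine ⟨unshiftA (α : ℂ) (invSchur (s 0) b w), fun j hj => ?_,
    (hpair'.kgg_iff h0.mp hH ?_).2 hw⟩
  · rw [← hcompress j hj]
    conv_rhs => rw [← unshiftA_shiftA (α : ℂ) (_root_.compress (s 0 * b) (m + 1) s)]
    refine unshiftA_congr fun i hi => ?_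
    have := hcs.invSchur_eq (d := w) (j := i) fun k hk => hws k (by omega)
    rw [← this]
    congr 1
    exact (compress_mul_mp_zero h0).symm
  · rw [unshiftA, invSchur]
    exact hs.posSemidef_zero

theorem Kgg.exists_extension_succ_iff {m : ℕ} {s : ℕ → Matrix (Fin q) (Fin q) ℂ}
    (hs : Kgg α (m + 1 : ℕ) s) :
    (∃ t, (∀ j ≤ m + 1, t j = s j) ∧ Kgg α (m + 1 + 1 : ℕ) t) ↔
      LinearMap.ker (s 0).mulVecLin ≤ LinearMap.ker (s (m + 1)).mulVecLin ∧
      ∃ u, (∀ j ≤ m, u j = _root_.schur1 (α : ℂ) s j) ∧ Kgg α (m + 1 : ℕ) u := by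
  constructor
  · rintro ⟨t, hts, ht⟩
    have h0 := hs.isHermitian (Nat.zero_le _)
    have ht0 := ht.isHermitian (Nat.zero_le _)
    refine ⟨?_, _root_.schur1 (α : ℂ) t, fun j hj => ?_, ht.schur1⟩
    · rw [← hts 0 (by omega), ← hts (m + 1) le_rfl]
      exact ht.ker_le (by omega)
    · have hc : _root_.compress (s 0 * mp (s 0)) (m + 1) s =
          _root_.compress (t 0 * mp (t 0)) (m + 1) t := by
        funext i
        simp only [_root_.compress]
        split_ifs with hi
        · rw [hts 0 (by omega), hts i hi]
        · rfl
      rw [← schur1_compress (N := m + 1) _ h0 (by omega),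
        ← schur1_compress (N := m + 1) _ ht0 (by omega), hc]
  · rintro ⟨hker, u, hus, hu⟩
    exact hs.exists_extension_of_schur1 hker hu hus

theorem Kgg.exists_extension_iff {m : ℕ} {s : ℕ → Matrix (Fin q) (Fin q) ℂ}
    (hs : Kgg α m s) :
    (∃ t, (∀ j ≤ m, t j = s j) ∧ Kgg α (m + 1 : ℕ) t) ↔
      ∀ k < m, LinearMap.ker (((_root_.schur1 (α : ℂ))^[k] s 0).mulVecLin) ≤
        LinearMap.ker (((_root_.schur1 (α : ℂ))^[k] s (m - k)).mulVecLin) := by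
  induction m generalizing s with
  | zero =>
    refine iff_of_true ⟨fun j => if j = 0 then s 0 else (α : ℂ) • s 0, ?_, ?_⟩ (by simp)
    · intro j hj
      simp [Nat.le_zero.1 hj]
    · have h : Kgg α (0 : ℕ) fun j => if j = 0 then s 0 else (α : ℂ) • s 0 :=
        hs.congr fun j hj => by simp [Nat.le_zero.1 hj]
      rw [_root_.kgg_iff]
      refine ⟨fun n hn => h.1 n ?_, fun n hn => ?_⟩
      · have := Nat.cast_le.1 hn
        exact_mod_cast (by omega : 2 * n ≤ 0)
      · have := Nat.cast_le.1 hn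
        obtain rfl : n = 0 := by omega
        convert PosSemidef.zero
        ext x y
        simp [comp_apply, shiftA]
  | succ m ih =>
    rw [hs.exists_extension_succ_iff, ih hs.schur1]
    constructor
    · rintro ⟨h0, h⟩ k hk
      cases k with
      | zero => exact h0
      | succ k =>
        rw [Nat.add_sub_add_right]
        exact h k (by omega)
    · intro h
      refine ⟨h 0 (by omega), fun k hk => ?_⟩
      have := h (k + 1) (by omega)
      rwa [Nat.add_sub_add_right] at this

theorem mul_iterate_schur1 {z : ℂ} {p : Matrix (Fin q) (Fin q) ℂ}
    {s : ℕ → Matrix (Fin q) (Fin q) ℂ} (h : ∀ j, p * s j = s j) (k j : ℕ) :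
    p * (schur1 z)^[k] s j = (schur1 z)^[k] s j := by
  induction k generalizing s with
  | zero => exact h j
  | succ k ih =>
    refine ih fun j => ?_
    rw [_root_.schur1, ← Matrix.mul_assoc, ← Matrix.mul_assoc, h]

theorem iterate_schur1_mul {z : ℂ} {p : Matrix (Fin q) (Fin q) ℂ}
    {s : ℕ → Matrix (Fin q) (Fin q) ℂ} (h : ∀ j, s j * p = s j) (k j : ℕ) :
    (schur1 z)^[k] s j * p = (schur1 z)^[k] s j := by
  induction k generalizing s with
  | zero => exact h j
  | succ k ih =>
    refine ih fun j => ?_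
    rw [_root_.schur1, Matrix.mul_assoc, h]

theorem mul_Pjk {z : ℂ} {p : Matrix (Fin q) (Fin q) ℂ}
    {s : ℕ → Matrix (Fin q) (Fin q) ℂ} (h : ∀ j, p * s j = s j) (j k : ℕ) :
    p * Pjk z s j k = Pjk z s j k := by
  simp only [Pjk, mul_sub, ← Matrix.mul_assoc, mul_iterate_schur1 h]

theorem Pjk_mul {z : ℂ} {p : Matrix (Fin q) (Fin q) ℂ}
    {s : ℕ → Matrix (Fin q) (Fin q) ℂ} (h : ∀ j, s j * p = s j) (j k : ℕ) :
    Pjk z s j k * p = Pjk z s j k := by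
  simp only [Pjk, sub_mul, Matrix.mul_assoc, iterate_schur1_mul h]

theorem Matrix.IsHermitian.mul_mp_mul_eq_zero_iff {A S : Matrix (Fin q) (Fin q) ℂ}
    (hA : A.IsHermitian) (hS : S.IsHermitian) :
    S - A * _root_.mp A * S * _root_.mp A * A = 0 ↔
      LinearMap.ker A.mulVecLin ≤ LinearMap.ker S.mulVecLin := by
  have hmp := hA.isMP_mp
  rw [hA.ker_le_iff, sub_eq_zero]
  constructor
  · intro h
    rw [h]
    simp only [Matrix.mul_assoc]
    rw [← Matrix.mul_assoc A (_root_.mp A) A, hmp.1]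
  · intro h
    have h' := congrArg (fun X => Xᴴ) h
    simp only [conjTranspose_mul, hA.eq, hA.mp.eq, hS.eq] at h'
    rw [Matrix.mul_assoc (A * _root_.mp A * S), Matrix.mul_assoc (A * _root_.mp A), ← Matrix.mul_assoc S, h,
      Matrix.mul_assoc, h']

theorem Kgg.sum_Pjk_eq_zero_iff {m : ℕ} {s : ℕ → Matrix (Fin q) (Fin q) ℂ}
    (hs : Kgg α m s) :
    ∑ k ∈ Finset.range m, Pjk (α : ℂ) s (m - k) k = 0 ↔
      ∀ k < m, LinearMap.ker (((_root_.schur1 (α : ℂ))^[k] s 0).mulVecLin) ≤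
        LinearMap.ker (((_root_.schur1 (α : ℂ))^[k] s (m - k)).mulVecLin) := by
  induction m generalizing s with
  | zero => simp
  | succ m ih =>
    have h0 := hs.isHermitian (Nat.zero_le _)
    have hS := hs.isHermitian le_rfl
    have hmp := h0.isMP_mp
    have hPjk : ∀ k, Pjk (α : ℂ) s (m + 1 - (k + 1)) (k + 1) =
        Pjk (α : ℂ) (_root_.schur1 (α : ℂ) s) (m - k) k := by
      intro k
      rw [Nat.add_sub_add_right]
      rfl
    have hsplit : (∀ k < m + 1, LinearMap.ker (((_root_.schur1 (α : ℂ))^[k] s 0).mulVecLin) ≤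
        LinearMap.ker (((_root_.schur1 (α : ℂ))^[k] s (m + 1 - k)).mulVecLin)) ↔
        (∀ k < m, LinearMap.ker
          (((_root_.schur1 (α : ℂ))^[k] (_root_.schur1 (α : ℂ) s) 0).mulVecLin) ≤
        LinearMap.ker
          (((_root_.schur1 (α : ℂ))^[k] (_root_.schur1 (α : ℂ) s) (m - k)).mulVecLin)) ∧
        LinearMap.ker (s 0).mulVecLin ≤ LinearMap.ker (s (m + 1)).mulVecLin := by
      constructor
      · intro h
        refine ⟨fun k hk => ?_, h 0 (by omega)⟩
        have := h (k + 1) (by omega)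
        rwa [Nat.add_sub_add_right] at this
      · rintro ⟨h, h0⟩ k hk
        cases k with
        | zero => exact h0
        | succ k =>
          rw [Nat.add_sub_add_right]
          exact h k (by omega)
    rw [Finset.sum_range_succ', hsplit, ← ih hs.schur1, Nat.sub_zero]
    simp only [hPjk]
    set Z := ∑ k ∈ Finset.range m, Pjk (α : ℂ) (_root_.schur1 (α : ℂ) s) (m - k) k with hZ
    rw [← h0.mul_mp_mul_eq_zero_iff hS]
    have hP : Pjk (α : ℂ) s (m + 1) 0 =
        s (m + 1) - s 0 * mp (s 0) * s (m + 1) * mp (s 0) * s 0 := rfl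
    rw [← hP]
    refine ⟨fun h => ?_, fun h => by rw [h.1, h.2, add_zero]⟩
    have hpZ : s 0 * mp (s 0) * Z = Z := by
      rw [hZ, Finset.mul_sum]
      refine Finset.sum_congr rfl fun k _ => mul_Pjk (fun j => ?_) _ _
      rw [_root_.schur1, ← Matrix.mul_assoc, ← Matrix.mul_assoc, hmp.1]
    have hZp : Z * (mp (s 0) * s 0) = Z := by
      rw [hZ, Finset.sum_mul]
      refine Finset.sum_congr rfl fun k _ => Pjk_mul (fun j => ?_) _ _
      rw [_root_.schur1, Matrix.mul_assoc, ← Matrix.mul_assoc (s 0), hmp.1]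
    have hPZ : Pjk (α : ℂ) s (m + 1) 0 = -Z := by rw [eq_neg_iff_add_eq_zero, add_comm, h]
    have hzero : s 0 * mp (s 0) * Pjk (α : ℂ) s (m + 1) 0 * (mp (s 0) * s 0) = 0 := by
      rw [hP, mul_sub, sub_mul, sub_eq_zero]
      simp only [← Matrix.mul_assoc]
      rw [hmp.1]
      simp only [Matrix.mul_assoc]
      rw [← Matrix.mul_assoc (s 0) (mp (s 0)) (s 0), hmp.1]
    have hPz : Pjk (α : ℂ) s (m + 1) 0 = 0 := by
      rw [← hzero, hPZ, Matrix.mul_neg, Matrix.neg_mul, hpZ, hZp]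
    refine ⟨?_, hPz⟩
    rwa [hPz, add_zero] at h

end Extension

/-- Proposition 9.5: an α-Stieltjes right-nonnegative definite sequence is extendable
    iff Z_{m,m} = 0, which is equivalent to the kernel inclusions
    ker(s_0^{[k,α]}) ⊆ ker(s_{m−k}^{[k,α]}) for all 0 ≤ k ≤ m−1. -/
theorem stmt14 {q : ℕ} (α : ℝ) (m : ℕ)
    (s : ℕ → Matrix (Fin q) (Fin q) ℂ) (hs : Kgg α (m : ℕ∞) s) :
    ((∃ t : ℕ → Matrix (Fin q) (Fin q) ℂ,
        (∀ j : ℕ, j ≤ m → t j = s j) ∧ Kgg α ((m + 1 : ℕ) : ℕ∞) t) ↔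
      ∑ k ∈ Finset.range m, Pjk (α : ℂ) s (m - k) k = 0) ∧
    (∑ k ∈ Finset.range m, Pjk (α : ℂ) s (m - k) k = 0 ↔
      ∀ k : ℕ, k < m →
        LinearMap.ker (Matrix.mulVecLin ((schur1 (α : ℂ))^[k] s 0)) ≤
          LinearMap.ker (Matrix.mulVecLin ((schur1 (α : ℂ))^[k] s (m - k)))) := by
  exact ⟨hs.exists_extension_iff.trans hs.sum_Pjk_eq_zero_iff.symm, hs.sum_Pjk_eq_zero_iff⟩
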